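/- Let m_X, m_Y, Ω_X, Ω_Y, α, γ̄ > 0 be real numbers with m_XΩ_Y < m_YΩ_X, let C_α = [Γ(m_X)/(Γ(m_X + 2/α) · ₂F₁(m_Y, −2/α; m_X; −m_XΩ_Y/(m_YΩ_X)))]^{α/2}, and let f be the α-Beaulieu-Xie shadowed SNR probability density with normalizing constant C_α. Then for every real k > 0, the k-th raw moment of the instantaneous SNR satisfies ∫₀^∞ γ^k f(γ) dγ = γ̄^k · (Γ(m_X)/Γ(m_X + 2/α))^k · (Γ(m_X + 2k/α)/Γ(m_X)) · ₂F₁(m_Y, −2k/α; m_X; −m_XΩ_Y/(m_YΩ_X)) / (₂F₁(m_Y, −2/α; m_X; −m_XΩ_Y/(m_YΩ_X)))^k. -/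

import Mathlib

open Real MeasureTheory Set

/-- Pochhammer symbol `(q)_n = q (q+1) ⋯ (q+n-1)`, with `(q)_0 = 1`. -/
noncomputable def poch (q : ℝ) (n : ℕ) : ℝ := ∏ i ∈ Finset.range n, (q + i)

/-- Confluent (Kummer) hypergeometric function `₁F₁(a; b; z)`. -/
noncomputable def oneF1 (a b z : ℝ) : ℝ :=
  ∑' n : ℕ, (poch a n / poch b n) * z ^ n / (n.factorial : ℝ)

/-- Gauss hypergeometric function `₂F₁(a, b; c; z)`. -/
noncomputable def twoF1 (a b c z : ℝ) : ℝ :=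
  ∑' n : ℕ, (poch a n * poch b n / poch c n) * z ^ n / (n.factorial : ℝ)

/-- Confluent Appell (Humbert) function `Φ₂(b₁, b₂; c; x, y)`. -/
noncomputable def Phi2 (b₁ b₂ c x y : ℝ) : ℝ :=
  ∑' p : ℕ × ℕ, (poch b₁ p.1 * poch b₂ p.2 / poch c (p.1 + p.2)) *
    x ^ p.1 * y ^ p.2 / ((p.1.factorial : ℝ) * (p.2.factorial : ℝ))

/-- The α-Beaulieu-Xie shadowed SNR probability density with parameters
`mX, mY, ΩX, ΩY, α`, average SNR `γbar` and normalizing constant `C`, where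
`θ = mY ΩX / (mY ΩX + mX ΩY)` and `δ = mX ΩY / (mY ΩX + mX ΩY)`. -/
noncomputable def aBXpdf (mX mY ΩX ΩY α γbar C γ : ℝ) : ℝ :=
  (α * (mY * ΩX / (mY * ΩX + mX * ΩY)) ^ mY / (2 * C ^ mX * Real.Gamma mX * γbar)) *
    (γ / γbar) ^ (α * mX / 2 - 1) * Real.exp (-(1 / C) * (γ / γbar) ^ (α / 2)) *
    oneF1 mY mX ((mX * ΩY / (mY * ΩX + mX * ΩY)) / C * (γ / γbar) ^ (α / 2))

lemma poch_succ (q : ℝ) (n : ℕ) : poch q (n + 1) = poch q n * (q + n) :=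
  Finset.prod_range_succ _ _

lemma poch_succ_left (q : ℝ) (n : ℕ) : poch q (n + 1) = q * poch (q + 1) n := by
  simp only [poch, Finset.prod_range_succ', Nat.cast_add, Nat.cast_one, Nat.cast_zero, add_zero]
  rw [mul_comm]
  congr 1
  exact Finset.prod_congr rfl fun i _ => by ring

lemma poch_add (q : ℝ) (n m : ℕ) : poch q (n + m) = poch q n * poch (q + n) m := by
  simp only [poch, Finset.prod_range_add, Nat.cast_add, add_assoc]

lemma poch_pos {q : ℝ} (hq : 0 < q) (n : ℕ) : 0 < poch q n :=
  Finset.prod_pos fun i _ => by positivity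

lemma abs_poch_le (q : ℝ) (n : ℕ) : |poch q n| ≤ poch (|q| + 1) n := by
  rw [poch, Finset.abs_prod]
  refine Finset.prod_le_prod (fun _ _ => abs_nonneg _) fun i _ => ?_
  have := abs_add_le q i
  rw [Nat.abs_cast] at this
  linarith

lemma choose_add_sub_one (a : ℝ) (n : ℕ) :
    Ring.choose (a + n - 1) n = poch a n / (n.factorial : ℝ) := by
  have h : (n.factorial : ℝ) * Ring.multichoose a n = poch a n := by
    rw [← nsmul_eq_mul, Ring.factorial_nsmul_multichoose_eq_ascPochhammer,
      Polynomial.ascPochhammer_smeval_eq_eval]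
    induction n with
    | zero => simp [poch]
    | succ n ih => rw [ascPochhammer_succ_eval, ih, poch_succ]
  rw [eq_div_iff (by positivity), mul_comm, ← h, Ring.choose]
  congr 2
  ring

/-- The binomial series of `(1 - z) ^ (-a)`. -/
lemma hasSum_poch_mul_pow (a : ℝ) {z : ℝ} (hz : |z| < 1) :
    HasSum (fun n : ℕ => poch a n / (n.factorial : ℝ) * z ^ n) ((1 - z) ^ (-a)) := by
  have h := (Real.one_div_one_sub_rpow_hasFPowerSeriesOnBall_zero a).hasSum (y := z)
    (by simpa [enorm_eq_nnnorm, ← NNReal.coe_lt_coe] using hz)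
  simp only [FormalMultilinearSeries.ofScalars_apply_eq, choose_add_sub_one, smul_eq_mul,
    zero_add, one_div] at h
  rwa [rpow_neg (by linarith [(abs_lt.1 hz).2])]

/-- The Chu–Vandermonde identity. -/
lemma sum_choose_mul_poch_div_poch (N : ℕ) {c : ℝ} (hc : 0 < c) (d : ℝ) :
    ∑ n ∈ Finset.range (N + 1), (-1) ^ n * (N.choose n : ℝ) * (poch d n / poch c n)
      = poch (c - d) N / poch c N := by
  induction N generalizing c d with
  | zero => simp [poch]
  | succ N ih =>
    have hc' : 0 < c + 1 := by linarith
    have h1 := ih hc d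
    have h2 := ih hc' (d + 1)
    have hN : poch c (N + 1) = c * poch (c + 1) N := poch_succ_left c N
    have hN' : poch c (N + 1) = poch c N * (c + N) := poch_succ c N
    have p1 := (poch_pos hc N).ne'
    have p2 := (poch_pos hc' N).ne'
    have hcN : c + N ≠ 0 := by positivity
    have e : ∑ n ∈ Finset.range (N + 1 + 1),
        (-1) ^ n * ((N + 1).choose n : ℝ) * (poch d n / poch c n)
        = ∑ n ∈ Finset.range (N + 1), (-1) ^ n * (N.choose n : ℝ) * (poch d n / poch c n)
          - d / c * ∑ n ∈ Finset.range (N + 1),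
            (-1) ^ n * (N.choose n : ℝ) * (poch (d + 1) n / poch (c + 1) n) := by
      have e1 : ∑ n ∈ Finset.range (N + 1), (-1) ^ n * (N.choose n : ℝ) * (poch d n / poch c n)
          = ∑ n ∈ Finset.range (N + 1 + 1),
            (-1) ^ n * (N.choose n : ℝ) * (poch d n / poch c n) := by
        rw [Finset.sum_range_succ _ (N + 1)]
        simp
      rw [e1, Finset.sum_range_succ' _ (N + 1), Finset.sum_range_succ' _ (N + 1), Finset.mul_sum,
        add_sub_right_comm, ← Finset.sum_sub_distrib]
      simp only [Nat.choose_zero_right]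
      congr 1
      refine Finset.sum_congr rfl fun n _ => ?_
      have := (poch_pos hc' n).ne'
      rw [Nat.choose_succ_succ, poch_succ_left, poch_succ_left]
      push_cast
      field_simp
      ring
    rw [e, h1, h2, show c + 1 - (d + 1) = c - d by ring, poch_succ (c - d)]
    have hq : poch (c + 1) N = poch c N * (c + N) / c := by
      rw [← hN', hN]; field_simp
    rw [hN', hq]
    field_simp
    ring

lemma summable_twoF1_of_pos {a b c z : ℝ} (ha : 0 < a) (hb : 0 < b) (hc : 0 < c) (hz : |z| < 1) :
    Summable fun n : ℕ => (poch a n * poch b n / poch c n) * z ^ n / (n.factorial : ℝ) := by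
  rcases eq_or_ne z 0 with rfl | hz0
  · refine summable_of_ne_finset_zero (s := {0}) fun n hn => ?_
    simp [show n ≠ 0 by simpa using hn]
  refine summable_of_ratio_test_tendsto_lt_one hz (Filter.Eventually.of_forall fun n => ?_) ?_
  · have := poch_pos ha n
    have := poch_pos hb n
    have := poch_pos hc n
    positivity
  · have key : ∀ n : ℕ, ‖(poch a (n + 1) * poch b (n + 1) / poch c (n + 1)) * z ^ (n + 1) /
        ((n + 1).factorial : ℝ)‖ / ‖(poch a n * poch b n / poch c n) * z ^ n / (n.factorial : ℝ)‖
        = (a + n) / (c + n) * ((b + n) / (1 + n)) * |z| := by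
      intro n
      have h1 := poch_pos ha n
      have h2 := poch_pos hb n
      have h3 := poch_pos hc n
      have h4 : 0 < |z| := abs_pos.2 hz0
      rw [poch_succ, poch_succ, poch_succ, Nat.factorial_succ]
      simp only [norm_mul, norm_div, norm_pow, Real.norm_eq_abs, Nat.cast_mul, abs_of_pos h1,
        abs_of_pos h2, abs_of_pos h3, Nat.abs_cast, Nat.cast_add, Nat.cast_one,
        abs_of_pos (show 0 < a + n by positivity), abs_of_pos (show 0 < b + n by positivity),
        abs_of_pos (show 0 < c + n by positivity),
        abs_of_pos (show (0 : ℝ) < n + 1 by positivity)]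
      field_simp
      ring
    simp only [key]
    have lim : ∀ x y : ℝ, Filter.Tendsto (fun n : ℕ => (x + n) / (y + n)) Filter.atTop
        (nhds 1) := by
      intro x y
      simpa using tendsto_add_mul_div_add_mul_atTop_nhds x y 1 (one_ne_zero (α := ℝ))
    simpa using ((lim a c).mul (lim b 1)).mul_const |z|

lemma summable_abs_twoF1 {a b c z : ℝ} (ha : 0 < a) (hc : 0 < c) (hz : |z| < 1) :
    Summable fun n : ℕ => |(poch a n * poch b n / poch c n) * z ^ n / (n.factorial : ℝ)| := by
  refine (summable_twoF1_of_pos ha (show 0 < |b| + 1 by positivity) hc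
    (show |(|z|)| < 1 by rwa [abs_abs])).of_nonneg_of_le (fun _ => abs_nonneg _) fun n => ?_
  have h1 := poch_pos ha n
  have h3 := poch_pos hc n
  rw [abs_div, abs_mul, abs_div, abs_mul, abs_pow, abs_of_pos h1, abs_of_pos h3, Nat.abs_cast]
  gcongr
  exact abs_poch_le b n

/-- Pfaff's transformation of the Gauss hypergeometric function. -/
lemma twoF1_pfaff {a b c z : ℝ} (ha : 0 < a) (hc : 0 < c) (hz0 : 0 ≤ z) (hz : z < 1 / 2) :
    twoF1 a b c z = (1 - z) ^ (-a) * twoF1 a (c - b) c (-(z / (1 - z))) := by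
  have hz1 : 0 < 1 - z := by linarith
  have hza : |z| < 1 := by rw [abs_of_nonneg hz0]; linarith
  have hw0 : 0 ≤ z / (1 - z) := by positivity
  have hw : |(-(z / (1 - z)))| < 1 := by
    rw [abs_neg, abs_of_nonneg hw0, div_lt_one hz1]; linarith
  set A : ℕ → ℝ := fun n => poch a n * poch (c - b) n / poch c n * (-z) ^ n / (n.factorial : ℝ)
    with hA
  set B : ℕ → ℕ → ℝ := fun n m => poch (a + n) m / (m.factorial : ℝ) * z ^ m with hB
  have hB0 : ∀ n m, 0 ≤ B n m := fun n m => by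
    have := poch_pos (show 0 < a + n by positivity) m
    positivity
  have hBs : ∀ n : ℕ, HasSum (B n) ((1 - z) ^ (-(a + n))) := fun n =>
    hasSum_poch_mul_pow (a + n) hza
  have hAB : ∀ n : ℕ, A n * (1 - z) ^ (-(a + n)) = (1 - z) ^ (-a) *
      (poch a n * poch (c - b) n / poch c n * (-(z / (1 - z))) ^ n / (n.factorial : ℝ)) := by
    intro n
    rw [neg_add, rpow_add hz1, rpow_neg hz1.le (n : ℝ), rpow_natCast, hA, ← neg_div, div_pow]
    field_simp
  have hF : Summable fun p : ℕ × ℕ => A p.1 * B p.1 p.2 := by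
    rw [← summable_abs_iff, summable_prod_of_nonneg (fun _ => abs_nonneg _)]
    simp only [abs_mul, abs_of_nonneg (hB0 _ _)]
    refine ⟨fun n => (hBs n).summable.mul_left _, ?_⟩
    simp only [tsum_mul_left, (hBs _).tsum_eq]
    refine ((summable_abs_twoF1 (b := c - b) ha hc hw).mul_left ((1 - z) ^ (-a))).congr fun n => ?_
    rw [← abs_of_pos (rpow_pos_of_pos hz1 (-a)), ← abs_mul, ← hAB, abs_mul,
      abs_of_pos (rpow_pos_of_pos hz1 _)]
  have h1 : ∑' p : ℕ × ℕ, A p.1 * B p.1 p.2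
      = (1 - z) ^ (-a) * twoF1 a (c - b) c (-(z / (1 - z))) := by
    rw [hF.tsum_prod]
    simp only [tsum_mul_left, (hBs _).tsum_eq, hAB]
    rfl
  rw [← h1, ← Finset.HasAntidiagonal.sigmaAntidiagonalEquivProd.tsum_eq]
  have hF' := Finset.HasAntidiagonal.sigmaAntidiagonalEquivProd.summable_iff.2 hF
  refine Eq.trans ?_ (hF'.tsum_sigma' fun n => (hasSum_fintype _).summable).symm
  refine tsum_congr fun N => ?_
  rw [tsum_fintype]
  simp only [Function.comp, Finset.HasAntidiagonal.sigmaAntidiagonalEquivProd_apply]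
  rw [Finset.sum_coe_sort (Finset.HasAntidiagonal.antidiagonal N)
      (fun p : ℕ × ℕ => A p.1 * B p.1 p.2),
    Finset.Nat.sum_antidiagonal_eq_sum_range_succ (fun n m => A n * B n m)]
  have hCV := sum_choose_mul_poch_div_poch N hc (c - b)
  rw [sub_sub_cancel] at hCV
  rw [mul_div_assoc (poch a N), ← hCV, Finset.mul_sum, Finset.sum_mul, Finset.sum_div]
  refine Finset.sum_congr rfl fun n hn => ?_
  have hnN : n ≤ N := Nat.lt_succ_iff.1 (Finset.mem_range.1 hn)
  obtain ⟨m, rfl⟩ := Nat.exists_eq_add_of_le hnN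
  have h3 := (poch_pos hc n).ne'
  simp only [hA, hB, add_tsub_cancel_left]
  rw [Nat.cast_add_choose, poch_add, neg_pow z, pow_add]
  field_simp

lemma Gamma_add_nat {r : ℝ} (hr : 0 < r) (n : ℕ) :
    Real.Gamma (r + n) = Real.Gamma r * poch r n := by
  induction n with
  | zero => simp [poch]
  | succ n ih =>
    rw [Nat.cast_succ, ← add_assoc, Real.Gamma_add_one (by positivity), ih, poch_succ]
    ring

lemma twoF1_pos {a b c z : ℝ} (ha : 0 < a) (hb : 0 < b) (hc : 0 < c) (hz0 : 0 ≤ z) (hz : z < 1) :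
    0 < twoF1 a b c z := by
  refine (summable_twoF1_of_pos ha hb hc (by rwa [abs_of_nonneg hz0])).tsum_pos
    (fun n => ?_) 0 (by simp [poch])
  have := poch_pos ha n
  have := poch_pos hb n
  have := poch_pos hc n
  positivity

/-- The Mellin-type transform of `₁F₁` against a stretched exponential. -/
lemma integral_rpow_mul_exp_mul_oneF1 {a c r p C δ : ℝ} (ha : 0 < a) (hc : 0 < c) (hr : 0 < r)
    (hp : 0 < p) (hC : 0 < C) (hδ0 : 0 ≤ δ) (hδ : δ < 1) :
    ∫ u in Ioi (0 : ℝ), u ^ (p * r - 1) * Real.exp (-(1 / C) * u ^ p) * oneF1 a c (δ / C * u ^ p)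
      = C ^ r / p * Real.Gamma r * twoF1 a r c δ := by
  set K : ℕ → ℝ := fun n => poch a n / poch c n * (δ / C) ^ n / (n.factorial : ℝ) with hK
  have hK0 : ∀ n, 0 ≤ K n := fun n => by
    have := poch_pos ha n
    have := poch_pos hc n
    positivity
  set G : ℕ → ℝ → ℝ := fun n u =>
    u ^ (p * (r + n) - 1) * Real.exp (-(1 / C) * u ^ p) with hG
  have hGi : ∀ n, ∫ u in Ioi (0 : ℝ), G n u
      = C ^ r * C ^ n / p * (Real.Gamma r * poch r n) := by
    intro n
    have hrn : 0 < p * (r + n) := by positivity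
    rw [hG, integral_rpow_mul_exp_neg_mul_rpow hp (by linarith) (by positivity), sub_add_cancel,
      neg_div, mul_div_cancel_left₀ _ hp.ne', Gamma_add_nat hr, one_div C,
      inv_rpow hC.le, ← rpow_neg hC.le, neg_neg, rpow_add hC, rpow_natCast]
    ring
  have hterm : ∀ n, ∫ u in Ioi (0 : ℝ), K n * G n u = C ^ r / p * Real.Gamma r *
      ((poch a n * poch r n / poch c n) * δ ^ n / (n.factorial : ℝ)) := by
    intro n
    simp only [integral_const_mul, hGi, hK, div_pow]
    field_simp
  have hGI : ∀ n, IntegrableOn (G n) (Ioi 0) := by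
    intro n
    refine Integrable.of_integral_ne_zero ?_
    rw [hGi]
    have := poch_pos hr n
    have := Real.Gamma_pos_of_pos hr
    positivity
  have hnorm : ∀ n, ∫ u in Ioi (0 : ℝ), ‖K n * G n u‖ = ∫ u in Ioi (0 : ℝ), K n * G n u := by
    intro n
    refine setIntegral_congr_fun measurableSet_Ioi fun u hu => ?_
    refine Real.norm_of_nonneg (mul_nonneg (hK0 n) ?_)
    exact mul_nonneg (rpow_nonneg (le_of_lt hu) _) (Real.exp_pos _).le
  have hs := integral_tsum_of_summable_integral_norm (F := fun n u => K n * G n u)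
    (μ := volume.restrict (Ioi (0 : ℝ))) (fun n => (hGI n).const_mul (K n)) (by
      simp only [hnorm, hterm]
      exact (summable_twoF1_of_pos ha hr hc (by rwa [abs_of_nonneg hδ0])).mul_left _)
  simp only [hterm, tsum_mul_left] at hs
  refine Eq.trans (setIntegral_congr_fun measurableSet_Ioi fun u hu => ?_) hs.symm
  have hu : 0 < u := hu
  simp only [oneF1, ← tsum_mul_left]
  refine tsum_congr fun n => ?_
  simp only [hK, hG]
  rw [show p * (r + n) - 1 = (p * r - 1) + p * n by ring, rpow_add hu, rpow_mul hu.le p,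
    rpow_natCast, mul_pow]
  ring

lemma integral_rpow_mul_aBXpdf {mX mY ΩX ΩY α γbar C k : ℝ} (hmX : 0 < mX) (hmY : 0 < mY)
    (hΩX : 0 < ΩX) (hΩY : 0 < ΩY) (hα : 0 < α) (hγbar : 0 < γbar) (hC : 0 < C) (hk : 0 < k) :
    ∫ γ in Ioi (0 : ℝ), γ ^ k * aBXpdf mX mY ΩX ΩY α γbar C γ
      = γbar ^ k * C ^ (2 * k / α) * (Real.Gamma (mX + 2 * k / α) / Real.Gamma mX) *
        ((mY * ΩX / (mY * ΩX + mX * ΩY)) ^ mY *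
          twoF1 mY (mX + 2 * k / α) mX (mX * ΩY / (mY * ΩX + mX * ΩY))) := by
  set θ := mY * ΩX / (mY * ΩX + mX * ΩY) with hθ
  set δ := mX * ΩY / (mY * ΩX + mX * ΩY) with hδ
  have hδ1 : δ < 1 := by
    rw [hδ, div_lt_one (by positivity)]
    linarith [mul_pos hmY hΩX]
  have hI := integral_rpow_mul_exp_mul_oneF1 hmY hmX (show 0 < mX + 2 * k / α by positivity)
    (show 0 < α / 2 by positivity) hC (show 0 ≤ δ by positivity) hδ1
  rw [← zero_mul γbar, ← integral_comp_mul_right_Ioi' _ 0 hγbar, smul_eq_mul]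
  have hG := Real.Gamma_pos_of_pos hmX
  have e : ∫ u in Ioi (0 : ℝ), (u * γbar) ^ k * aBXpdf mX mY ΩX ΩY α γbar C (u * γbar)
      = γbar ^ k * (α * θ ^ mY / (2 * C ^ mX * Real.Gamma mX * γbar)) *
        ∫ u in Ioi (0 : ℝ), u ^ (α / 2 * (mX + 2 * k / α) - 1) *
          Real.exp (-(1 / C) * u ^ (α / 2)) * oneF1 mY mX (δ / C * u ^ (α / 2)) := by
    rw [← integral_const_mul]
    refine setIntegral_congr_fun measurableSet_Ioi fun u hu => ?_
    have hu : 0 < u := hu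
    simp only [aBXpdf]
    rw [mul_div_cancel_right₀ _ hγbar.ne', mul_rpow hu.le hγbar.le,
      show α / 2 * (mX + 2 * k / α) - 1 = k + (α * mX / 2 - 1) by field_simp; ring,
      rpow_add hu, ← hθ, ← hδ]
    ring
  rw [e, hI, rpow_add hC]
  field_simp

/-- Theorem 2 of the paper: raw moments of the instantaneous SNR for the
α-Beaulieu-Xie shadowed model with the canonical normalizing constant `C_α`. -/
theorem statement_4 (mX mY ΩX ΩY α γbar : ℝ) (hmX : 0 < mX) (hmY : 0 < mY)
    (hΩX : 0 < ΩX) (hΩY : 0 < ΩY) (hα : 0 < α) (hγbar : 0 < γbar)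
    (hshad : mX * ΩY < mY * ΩX) (k : ℝ) (hk : 0 < k) :
    ∫ γ in Set.Ioi (0 : ℝ), γ ^ k *
        aBXpdf mX mY ΩX ΩY α γbar
          ((Real.Gamma mX / (Real.Gamma (mX + 2 / α) *
              twoF1 mY (-(2 / α)) mX (-(mX * ΩY / (mY * ΩX))))) ^ (α / 2)) γ
      = γbar ^ k * (Real.Gamma mX / Real.Gamma (mX + 2 / α)) ^ k *
        (Real.Gamma (mX + 2 * k / α) / Real.Gamma mX) *
        twoF1 mY (-(2 * k / α)) mX (-(mX * ΩY / (mY * ΩX))) /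
        (twoF1 mY (-(2 / α)) mX (-(mX * ΩY / (mY * ΩX)))) ^ k := by
  have hz : mX * ΩY / (mY * ΩX + mX * ΩY) < 1 / 2 := by
    rw [div_lt_div_iff₀ (by positivity) two_pos]
    linarith
  have hsub : 1 - mX * ΩY / (mY * ΩX + mX * ΩY) = mY * ΩX / (mY * ΩX + mX * ΩY) := by
    field_simp
    ring
  have hpf : ∀ s : ℝ, (mY * ΩX / (mY * ΩX + mX * ΩY)) ^ mY *
      twoF1 mY (mX + s) mX (mX * ΩY / (mY * ΩX + mX * ΩY))
      = twoF1 mY (-s) mX (-(mX * ΩY / (mY * ΩX))) := by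
    intro s
    have hθ : 0 < mY * ΩX / (mY * ΩX + mX * ΩY) := by positivity
    rw [twoF1_pfaff hmY hmX (by positivity) hz, hsub, ← mul_assoc, ← rpow_add hθ, add_neg_cancel,
      rpow_zero, one_mul, div_div_div_cancel_right₀ (by positivity), sub_add_cancel_left]
  have hFpos : 0 < twoF1 mY (-(2 / α)) mX (-(mX * ΩY / (mY * ΩX))) := by
    rw [← hpf]
    have := twoF1_pos hmY (show 0 < mX + 2 / α by positivity) hmX
      (show 0 ≤ mX * ΩY / (mY * ΩX + mX * ΩY) by positivity) (by linarith)
    positivity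
  have hG1 := Real.Gamma_pos_of_pos hmX
  have hG2 := Real.Gamma_pos_of_pos (show 0 < mX + 2 / α by positivity)
  rw [integral_rpow_mul_aBXpdf hmX hmY hΩX hΩY hα hγbar (by positivity) hk, hpf,
    ← rpow_mul (by positivity), show α / 2 * (2 * k / α) = k by field_simp, ← div_div,
    div_rpow (by positivity) hFpos.le]
  ring
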